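/- Let m⃗ ∈ Ind(F) be a highest weight singular vector of degree 3 over g = A(K'_4), written as T(m⃗) = Θ Σ_i η_{(i)^c} ⊗ v_{i,1} + Σ_i η_i ⊗ v_{i,0}. Then v_{a,1} = (−1)^{a+1}·2C·v_{a,0} for every a ∈ {1,2,3,4}, the central element C acts on F as the scalar 1/2 or −1/2, and t acts on F as the scalar 5/2. -/

import Mathlib

/-!
Core definitions modelling the annihilation superalgebra `𝔤 = 𝒜(K'₄) = K(1,4)₊ ⊕ ℂC`
and generalized Verma modules `Ind F ≅ ℂ[Θ] ⊗ Λ(η₁,…,η₄) ⊗ F` over it.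

Grassmann monomials `ξ_I`/`η_I` (with `I` in increasing order) are indexed by
`Idx = Finset (Fin 4)`.
-/

open Finset

noncomputable section

/-- Index set of a Grassmann monomial in `ξ₁,…,ξ₄` (0-indexed). -/
abbrev Idx : Type := Finset (Fin 4)

/-- Sign appearing when multiplying two Grassmann monomials: `ξ_I ξ_J = msign I J • ξ_{I ∪ J}`
(for `I, J` disjoint). -/
def msign (I J : Idx) : ℤ := (-1 : ℤ) ^ ((I ×ˢ J).filter (fun p => p.2 < p.1)).card

/-- Sign of `∂ᵢ ξ_I` (for `i ∈ I`): `∂ᵢ ξ_I = dsign i I • ξ_{I \ {i}}`. -/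
def dsign (i : Fin 4) (I : Idx) : ℤ := (-1 : ℤ) ^ (I.filter (fun j => j < i)).card

/-- Sign of the iterated derivative `∂_S η_L = ∂_{s₁} ⋯ ∂_{s_k} η_L` (`s₁ < ⋯ < s_k`,
`S ⊆ L`): `∂_S η_L = ddsign S L • η_{L \ S}`. -/
def ddsign (S L : Idx) : ℤ :=
  (-1 : ℤ) ^ (S.card * (S.card - 1) / 2) *
    (-1 : ℤ) ^ (∑ i ∈ S, ((L \ S).filter (fun j => j < i)).card)

/-- `epsSign I` is the sign `ε_I` of the permutation `(I, Iᶜ)` of `(1,2,3,4)`. -/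
def epsSign (I : Idx) : ℤ := msign I Iᶜ

variable (F : Type*) [AddCommGroup F] [Module ℂ F]

/-- The generalized Verma module `Ind F = ℂ[Θ] ⊗ Λ(η₁,…,η₄) ⊗ F`,
with `(k, L)`-component the coefficient of `Θ^k η_L`. -/
abbrev VInd : Type _ := (ℕ × Idx) →₀ F

variable {F}

/-- Basis-type element `Θ^k η_L ⊗ v` of `Ind F`. -/
def bv (k : ℕ) (L : Idx) (v : F) : VInd F := Finsupp.single (k, L) v

/-- Action of the central element `C` on `Ind F`: it acts through its action `ρC` on `F`. -/
def Cop (ρC : F →ₗ[ℂ] F) : VInd F →ₗ[ℂ] VInd F := Finsupp.mapRange.linearMap ρC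

/-- Multiplication by `Θ` on `Ind F`. -/
def thOp : VInd F →ₗ[ℂ] VInd F := Finsupp.lmapDomain F ℂ (fun p => (p.1 + 1, p.2))

/-- The 2-cocycle `ψ` on `K(1,4)₊` defining the central extension `𝒜(K'₄)`, evaluated on the
basis monomials `t^0 ξ_I`, `t^0 ξ_J`: the only nonzero values are
`ψ(1, ξ₁₂₃₄) = -2`, `ψ(ξ₁₂₃₄, 1) = 2` and `ψ(ξ_i, ξ_{{i}ᶜ}) = ψ(ξ_{{i}ᶜ}, ξ_i) = -∂ᵢ-sign`
(equivalently `ψ(ξ_i, ∂ᵢξ₁₂₃₄) = -1`). -/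
def psi0 (I J : Idx) : ℂ :=
  (if I = (∅ : Idx) ∧ J = (Finset.univ : Idx) then (-2 : ℂ) else 0)
  + (if I = (Finset.univ : Idx) ∧ J = (∅ : Idx) then (2 : ℂ) else 0)
  + ∑ i : Fin 4, (if I = ({i} : Idx) ∧ J = ({i}ᶜ : Idx) then (-(dsign i Finset.univ) : ℂ) else 0)
  + ∑ i : Fin 4, (if I = ({i}ᶜ : Idx) ∧ J = ({i} : Idx) then (-(dsign i Finset.univ) : ℂ) else 0)

/-- The action on `Ind F` of the bracket `[t^m ξ_I, t^n ξ_J]` in `𝒜(K'₄) = K(1,4)₊ ⊕ ℂC`,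
namely of
`(2n-2m-n|I|+m|J|) t^{m+n-1} ξ_{IJ} + (-1)^{|I|} t^{m+n} ∑ᵢ ∂ᵢξ_I ∂ᵢξ_J + ψ(t^mξ_I, t^nξ_J) C`,
expressed through a family `act` of operators (the actions of the `t^m ξ_I`). -/
def brkAct (ρC : F →ₗ[ℂ] F) (act : ℕ → Idx → (VInd F →ₗ[ℂ] VInd F))
    (m : ℕ) (I : Idx) (n : ℕ) (J : Idx) : VInd F →ₗ[ℂ] VInd F :=
  ((2 * (n : ℤ) - 2 * (m : ℤ) - (n : ℤ) * I.card + (m : ℤ) * J.card : ℤ) : ℂ) •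
      (if Disjoint I J then ((msign I J : ℤ) : ℂ) • act (m + n - 1) (I ∪ J) else 0)
  + ((-1 : ℂ) ^ I.card) • (∑ i : Fin 4,
      if i ∈ I ∧ i ∈ J ∧ Disjoint (I.erase i) (J.erase i) then
        ((dsign i I * dsign i J * msign (I.erase i) (J.erase i) : ℤ) : ℂ) •
          act (m + n) (I.erase i ∪ J.erase i)
      else 0)
  + (if m = 0 ∧ n = 0 then psi0 I J else 0) • Cop ρC

/-- The data of a generalized Verma module over `𝒜(K'₄)`:
the action `ρt, ρC, ρξ i j` of the degree-zero part `𝔤₀ = ⟨C, t, ξ_{ij}⟩` on `F`,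
and the action `act m I` of the basis elements `t^m ξ_I` of `K(1,4)₊` on
`Ind F = ℂ[Θ] ⊗ Λ(η) ⊗ F`. -/
structure VermaData (F : Type*) [AddCommGroup F] [Module ℂ F] where
  ρt : F →ₗ[ℂ] F
  ρC : F →ₗ[ℂ] F
  ρξ : Fin 4 → Fin 4 → (F →ₗ[ℂ] F)
  act : ℕ → Idx → (VInd F →ₗ[ℂ] VInd F)

/-- The properties characterizing the generalized Verma module `Ind F` over `𝒜(K'₄)`:
* `anti` : `ξ_{ij} = -ξ_{ji}`;
* `lie`  : `act` is an action of the Lie superalgebra `𝒜(K'₄) = K(1,4)₊ ⊕ ℂC`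
  (with `C` acting through `ρC`);
* `vac_pos` : the positive part `𝔤_{>0}` (spanned by the `t^m ξ_I` with `2m + |I| - 2 > 0`)
  kills the vacuum subspace `1 ⊗ F`;
* `vac_xi`, `vac_t` : `𝔤₀` acts on `1 ⊗ F` through `ρξ`, `ρt`;
* `low_eta`, `low_one` : the negative part acts by left multiplication in
  `U(𝔤_{<0}) = ℂ[Θ] ⊗ Λ(η₁,…,η₄)` (with `η_i² = Θ` and `ξ_∅ = -2Θ`). -/
structure IsVerma (D : VermaData F) : Prop where
  anti : ∀ i j, D.ρξ i j = - D.ρξ j i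
  lie : ∀ (m : ℕ) (I : Idx) (n : ℕ) (J : Idx),
      D.act m I ∘ₗ D.act n J - ((-1 : ℂ) ^ (I.card * J.card)) • (D.act n J ∘ₗ D.act m I)
        = brkAct D.ρC D.act m I n J
  vac_pos : ∀ (v : F) (m : ℕ) (I : Idx), 2 < 2 * m + I.card → D.act m I (bv 0 ∅ v) = 0
  vac_xi : ∀ (v : F) (i j : Fin 4), i < j →
      D.act 0 {i, j} (bv 0 ∅ v) = bv 0 ∅ (D.ρξ i j v)
  vac_t : ∀ v : F, D.act 1 ∅ (bv 0 ∅ v) = bv 0 ∅ (D.ρt v)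
  low_eta : ∀ (v : F) (k : ℕ) (L : Idx) (i : Fin 4),
      D.act 0 {i} (bv k L v) =
        if i ∈ L then ((dsign i L : ℤ) : ℂ) • bv (k + 1) (L.erase i) v
        else ((msign {i} L : ℤ) : ℂ) • bv k (insert i L) v
  low_one : ∀ (v : F) (k : ℕ) (L : Idx),
      D.act 0 ∅ (bv k L v) = (-2 : ℂ) • bv (k + 1) L v

/-- A (nonzero) singular vector: a nonzero vector killed by
`𝔤_{>0} = ⟨t^m ξ_I : 2m + |I| - 2 > 0⟩`. -/
def IsSingular (D : VermaData F) (u : VInd F) : Prop :=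
  u ≠ 0 ∧ ∀ (m : ℕ) (I : Idx), 2 < 2 * m + I.card → D.act m I u = 0

/-- `u` is homogeneous of degree `d` (`Θ^k η_L ⊗ v` has degree `2k + |L|`). -/
def HomogDeg (u : VInd F) (d : ℕ) : Prop := ∀ p ∈ u.support, 2 * p.1 + p.2.card = d

/-- `u` is a highest weight vector: it is killed by the positive root vectors
`e₁ = -ξ₁₃ + i ξ₂₃` and `e₂ = -ξ₂₄ - i ξ₁₄` of `𝔤₀` (0-indexed below). -/
def IsHW (D : VermaData F) (u : VInd F) : Prop :=
  Complex.I • D.act 0 {1, 2} u - D.act 0 {0, 2} u = 0 ∧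
  -(D.act 0 {1, 3} u) - Complex.I • D.act 0 {0, 3} u = 0

/-- `e₁ = e_x + e_y = -ξ₁₃ + i ξ₂₃` acting on `F`. -/
def e1F (D : VermaData F) : F →ₗ[ℂ] F := -(D.ρξ 0 2) + Complex.I • D.ρξ 1 2

/-- `e₂ = e_x - e_y = -ξ₂₄ - i ξ₁₄` acting on `F`. -/
def e2F (D : VermaData F) : F →ₗ[ℂ] F := -(D.ρξ 1 3) - Complex.I • D.ρξ 0 3

/-- `h_x = -iξ₁₂ + iξ₃₄` acting on `F`. -/
def hxF (D : VermaData F) : F →ₗ[ℂ] F := -(Complex.I • D.ρξ 0 1) + Complex.I • D.ρξ 2 3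

/-- `h_y = -iξ₁₂ - iξ₃₄` acting on `F`. -/
def hyF (D : VermaData F) : F →ₗ[ℂ] F := -(Complex.I • D.ρξ 0 1) - Complex.I • D.ρξ 2 3

/-- `f_x = (ξ₁₃ + ξ₂₄ - iξ₁₄ + iξ₂₃)/2` acting on `F`. -/
def fxF (D : VermaData F) : F →ₗ[ℂ] F :=
  (2 : ℂ)⁻¹ • (D.ρξ 0 2 + D.ρξ 1 3 - Complex.I • D.ρξ 0 3 + Complex.I • D.ρξ 1 2)

/-- `f_y = (ξ₁₃ - ξ₂₄ + iξ₁₄ + iξ₂₃)/2` acting on `F`. -/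
def fyF (D : VermaData F) : F →ₗ[ℂ] F :=
  (2 : ℂ)⁻¹ • (D.ρξ 0 2 - D.ρξ 1 3 + Complex.I • D.ρξ 0 3 + Complex.I • D.ρξ 1 2)

/-- `v` is a highest weight vector of `F` of weight `μ = (μ.1, μ.2.1, μ.2.2.1, μ.2.2.2)`
with respect to `(h_x, h_y, t, C)`. -/
def IsHWvec (D : VermaData F) (μ : ℂ × ℂ × ℂ × ℂ) (v : F) : Prop :=
  v ≠ 0 ∧ e1F D v = 0 ∧ e2F D v = 0 ∧ hxF D v = μ.1 • v ∧ hyF D v = μ.2.1 • v ∧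
    D.ρt v = μ.2.2.1 • v ∧ D.ρC v = μ.2.2.2 • v

/-- `F` is an irreducible `𝔤₀`-module. -/
def IsIrred (D : VermaData F) : Prop :=
  (∃ v : F, v ≠ 0) ∧ ∀ p : Submodule ℂ F,
    (∀ v ∈ p, D.ρt v ∈ p ∧ D.ρC v ∈ p ∧ ∀ i j, D.ρξ i j v ∈ p) → p = ⊥ ∨ p = ⊤

/-- The commutative-in-`Θ` algebra `U(𝔤_{<0}) = ℂ[Θ] ⊗ Λ(η₁,…,η₄)` (as a ℂ-module with
basis `Θ^k η_L`). -/
abbrev CA : Type := (ℕ × Idx) →₀ ℂ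

/-- Multiplication in `U(𝔤_{<0})` (`η_i² = Θ`, `Θ` central, `η_i η_j = -η_j η_i`). -/
def cmul (x y : CA) : CA :=
  x.sum fun p c => y.sum fun q c' =>
    Finsupp.single (p.1 + q.1 + (p.2 ∩ q.2).card, (p.2 \ q.2) ∪ (q.2 \ p.2))
      (c * c' * ((msign p.2 q.2 : ℤ) : ℂ))

/-- `w₁₁ = η₂ + i η₁`. -/
def w11 : CA := Finsupp.single (0, ({1} : Idx)) 1 + Complex.I • Finsupp.single (0, ({0} : Idx)) 1
/-- `w₂₂ = η₂ - i η₁`. -/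
def w22 : CA := Finsupp.single (0, ({1} : Idx)) 1 - Complex.I • Finsupp.single (0, ({0} : Idx)) 1
/-- `w₁₂ = -η₄ + i η₃`. -/
def w12 : CA := -Finsupp.single (0, ({3} : Idx)) 1 + Complex.I • Finsupp.single (0, ({2} : Idx)) 1
/-- `w₂₁ = η₄ + i η₃`. -/
def w21 : CA := Finsupp.single (0, ({3} : Idx)) 1 + Complex.I • Finsupp.single (0, ({2} : Idx)) 1

/-- `a ⊗ v ∈ U(𝔤_{<0}) ⊗ F = Ind F`. -/
def tens (a : CA) (v : F) : VInd F := a.sum fun p c => Finsupp.single p (c • v)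

end
noncomputable section
open Finset

variable {F : Type*} [AddCommGroup F] [Module ℂ F]

/-- The Hodge-duality isomorphism `T : Ind F → Ind F`, `Θ^k η_L ⊗ v ↦ Θ^k η̄_L ⊗ v`,
where `η̄_L` is the unique monomial with `η̄_L ⋆ ξ_L = η₁₂₃₄`, i.e.
`η̄_L = msign Lᶜ L • η_{Lᶜ}`.  In particular, the component of `T(u)` on the basis vector
`Θ^k η_L` is the vector `v_{L,k} ∈ F` of the decomposition `T(u) = ∑ Θ^k η_L ⊗ v_{L,k}`. -/
def Tmap : VInd F →ₗ[ℂ] VInd F :=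
  Finsupp.lsum ℂ (fun p => ((msign p.2ᶜ p.2 : ℤ) : ℂ) • Finsupp.lsingle (p.1, p.2ᶜ))

end

section Aux
variable {F : Type*} [AddCommGroup F] [Module ℂ F]

lemma aux_psi (I : Idx) (j : Fin 4) :
    psi0 I {j} = if I = ({j}ᶜ : Idx) then (-(dsign j Finset.univ) : ℂ) else 0 := by
  have h1 : ∀ j : Fin 4, ({j} : Idx) ≠ univ := by decide
  have h2 : ∀ j : Fin 4, ({j} : Idx) ≠ ∅ := by decide
  have h3 : ∀ i j : Fin 4, ({j} : Idx) ≠ {i}ᶜ := by decide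
  have h4 : ∀ i j : Fin 4, ({j} : Idx) = {i} ↔ j = i := by decide
  unfold psi0
  simp only [h1, h2, h3, h4, and_false, if_false, Finset.sum_const_zero, zero_add]
  rw [Finset.sum_eq_single j]
  · simp
  · intro b _ hb
    simp [Ne.symm hb]
  · simp

lemma aux_brk_eta (D : VermaData F) (m : ℕ) (I : Idx) (j : Fin 4) (w : VInd F) :
    brkAct D.ρC D.act m I 0 {j} w =
      (if j ∈ I then ((-1 : ℂ) ^ I.card * ((dsign j I : ℤ) : ℂ)) • D.act m (I.erase j) w
        else (-(m : ℂ) * ((msign I {j} : ℤ) : ℂ)) • D.act (m - 1) (insert j I) w)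
      + (if m = 0 ∧ I = ({j}ᶜ : Idx) then (-(dsign j Finset.univ) : ℂ) else 0) • Cop D.ρC w := by
  have e0 : ∀ j : Fin 4, dsign j {j} = 1 := by decide
  have e1 : ∀ I : Idx, msign I ∅ = 1 := by decide
  unfold brkAct
  rw [aux_psi, Finset.sum_eq_single j]
  · by_cases h : j ∈ I
    · simp [h, e0, e1, mul_smul]
      by_cases hm : m = 0 <;> by_cases hI : I = {j}ᶜ <;> simp [hm, hI]
    · have : I ∪ {j} = insert j I := by ext; simp
      simp [h, this, mul_smul]
      by_cases hm : m = 0 <;> by_cases hI : I = {j}ᶜ <;> simp [hm, hI] <;> module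
  · intro b _ hb
    simp [hb]
  · simp

lemma aux_step (D : VermaData F) (hD : IsVerma D) (m : ℕ) (I : Idx) (j : Fin 4) (w : VInd F) :
    D.act m I (D.act 0 {j} w) =
      ((-1 : ℂ) ^ I.card) • D.act 0 {j} (D.act m I w) +
      ((if j ∈ I then ((-1 : ℂ) ^ I.card * ((dsign j I : ℤ) : ℂ)) • D.act m (I.erase j) w
        else (-(m : ℂ) * ((msign I {j} : ℤ) : ℂ)) • D.act (m - 1) (insert j I) w)
      + (if m = 0 ∧ I = ({j}ᶜ : Idx) then (-(dsign j Finset.univ) : ℂ) else 0) • Cop D.ρC w) := by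
  have h := congrArg (fun f => f w) (hD.lie m I 0 {j})
  simp only [aux_brk_eta] at h
  rw [← h]
  simp

lemma aux_insert (D : VermaData F) (hD : IsVerma D) (m : ℕ) (I : Idx) (k : ℕ) (j : Fin 4)
    (L : Idx) (v : F) (_hI : 2 ≤ 2 * m + I.card) (hL : ∀ l ∈ L, j < l) :
    D.act m I (bv k (insert j L) v) =
      ((-1 : ℂ) ^ I.card) • D.act 0 {j} (D.act m I (bv k L v)) +
      ((if j ∈ I then ((-1 : ℂ) ^ I.card * ((dsign j I : ℤ) : ℂ)) • D.act m (I.erase j) (bv k L v)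
        else (-(m : ℂ) * ((msign I {j} : ℤ) : ℂ)) • D.act (m - 1) (insert j I) (bv k L v))
      + (if m = 0 ∧ I = ({j}ᶜ : Idx) then (-(dsign j Finset.univ) : ℂ) else 0) •
          bv k L (D.ρC v)) := by
  have h1 : j ∉ L := fun h => lt_irrefl _ (hL j h)
  have h2 : ∀ (j : Fin 4) (L : Idx), (∀ l ∈ L, j < l) → msign {j} L = 1 := by decide
  have h := aux_step D hD m I j (bv k L v)
  rw [hD.low_eta, if_neg h1, h2 j L hL] at h
  have hC : Cop D.ρC (bv k L v) = bv k L (D.ρC v) := by simp [Cop, bv]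
  rw [hC] at h
  simpa using h

lemma aux_single (D : VermaData F) (hD : IsVerma D) (m : ℕ) (I : Idx) (k : ℕ) (j : Fin 4)
    (v : F) (hI : 2 ≤ 2 * m + I.card) :
    D.act m I (bv k {j} v) =
      ((-1 : ℂ) ^ I.card) • D.act 0 {j} (D.act m I (bv k ∅ v)) +
      ((if j ∈ I then ((-1 : ℂ) ^ I.card * ((dsign j I : ℤ) : ℂ)) • D.act m (I.erase j) (bv k ∅ v)
        else (-(m : ℂ) * ((msign I {j} : ℤ) : ℂ)) • D.act (m - 1) (insert j I) (bv k ∅ v))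
      + (if m = 0 ∧ I = ({j}ᶜ : Idx) then (-(dsign j Finset.univ) : ℂ) else 0) •
          bv k ∅ (D.ρC v)) :=
  aux_insert D hD m I k j ∅ v hI (by simp)

/-- Moving an operator through `Θ`, on the vacuum. -/
lemma aux_theta (D : VermaData F) (hD : IsVerma D) (m : ℕ) (I : Idx) (v : F)
    (_hI : 2 ≤ 2 * m + I.card) :
    D.act m I (bv 1 ∅ v) = -((2 : ℂ)⁻¹ • D.act 0 ∅ (D.act m I (bv 0 ∅ v)))
      + (m : ℂ) • D.act (m - 1) I (bv 0 ∅ v)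
      - (if m = 0 ∧ I = (univ : Idx) then (1 : ℂ) else 0) • bv 0 ∅ (D.ρC v) := by
  have h := congrArg (fun f => f (bv 0 ∅ v)) (hD.lie m I 0 ∅)
  have e1 : ∀ I : Idx, msign I ∅ = 1 := by decide
  have e2 : ∀ i : Fin 4, (∅ : Idx) ≠ {i}ᶜ := by decide
  have e4 : ∀ i : Fin 4, (∅ : Idx) ≠ {i} := by decide
  have e3 : (∅ : Idx) ≠ univ := by decide
  have hC : Cop D.ρC (bv 0 ∅ v) = bv 0 ∅ (D.ρC v) := by simp [Cop, bv]
  simp only [brkAct, psi0, e1, e2, e3, e4, LinearMap.sub_apply, LinearMap.comp_apply, hD.low_one,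
    LinearMap.smul_apply, LinearMap.add_apply, hC, map_smul] at h
  by_cases hm : m = 0
  · subst hm
    by_cases hU : I = univ
    · simp [hU] at h ⊢
      linear_combination (norm := module) (-(1/2 : ℂ)) • h
    · simp [hU] at h ⊢
      linear_combination (norm := module) (-(1/2 : ℂ)) • h
  · simp [hm] at h ⊢
    linear_combination (norm := module) (-(1/2 : ℂ)) • h

lemma aux_decomp (u : VInd F) (hdeg : HomogDeg u 3) :
    u = bv 1 {0} (u (1, {0})) + bv 1 {1} (u (1, {1})) + bv 1 {2} (u (1, {2}))
      + bv 1 {3} (u (1, {3})) + bv 0 {1, 2, 3} (u (0, {1, 2, 3})) + bv 0 {0, 2, 3} (u (0, {0, 2, 3}))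
      + bv 0 {0, 1, 3} (u (0, {0, 1, 3})) + bv 0 {0, 1, 2} (u (0, {0, 1, 2})) := by
  have hz : ∀ p, 2 * p.1 + p.2.card ≠ 3 → u p = 0 := by
    intro p hp
    by_contra h
    exact hp (hdeg p (by simpa using h))
  have h1 : ∀ L : Idx, L.card = 1 → L = {0} ∨ L = {1} ∨ L = {2} ∨ L = {3} := by decide
  have h3 : ∀ L : Idx, L.card = 3 → L = {1, 2, 3} ∨ L = {0, 2, 3} ∨ L = {0, 1, 3} ∨ L = {0, 1, 2} := by
    decide
  ext ⟨k, L⟩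
  by_cases hp : 2 * k + L.card = 3
  · have hk : k = 0 ∨ k = 1 := by omega
    rcases hk with rfl | rfl
    · rcases h3 L (by omega) with rfl | rfl | rfl | rfl <;>
        simp (decide := true) [bv]
    · rcases h1 L (by omega) with rfl | rfl | rfl | rfl <;>
        simp (decide := true) [bv]
  · rw [hz _ hp]
    have : ∀ (k' : ℕ) (L' : Idx) (v : F), 2 * k' + L'.card = 3 → bv k' L' v (k, L) = 0 := by
      intro k' L' v h
      rw [bv, Finsupp.single_apply, if_neg]
      intro e
      simp only [Prod.mk.injEq] at e
      rw [e.1, e.2] at h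
      exact hp h
    simp (decide := true) [this]

end Aux
section Aux2
variable {F : Type*} [AddCommGroup F] [Module ℂ F]

lemma aux_sort : ({1, 0} : Idx) = {0, 1} ∧ ({2, 0} : Idx) = {0, 2} ∧ ({3, 0} : Idx) = {0, 3} ∧
    ({2, 1} : Idx) = {1, 2} ∧ ({3, 1} : Idx) = {1, 3} ∧ ({3, 2} : Idx) = {2, 3} := by decide

/-- The relations between the coefficients `a` of `Θη_i` and `b` of `η_{(i)ᶜ}`. -/
def AuxRel (D : VermaData F) (e : ℂ) (a b : F) : Prop :=
  a = e • D.ρC b ∧ D.ρt b = (5 / 2 : ℂ) • b ∧ D.ρC (D.ρC b) = (1 / 4 : ℂ) • b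

set_option maxHeartbeats 4000000 in
lemma aux_eqs (D : VermaData F) (hD : IsVerma D) (u : VInd F) (hdeg : HomogDeg u 3)
    (hs : ∀ (m : ℕ) (I : Idx), 2 < 2 * m + I.card → D.act m I u = 0) :
    AuxRel D (-2) (u (1, {0})) (u (0, {1, 2, 3})) ∧ AuxRel D 2 (u (1, {1})) (u (0, {0, 2, 3})) ∧
    AuxRel D (-2) (u (1, {2})) (u (0, {0, 1, 3})) ∧ AuxRel D 2 (u (1, {3})) (u (0, {0, 1, 2})) := by
  have X0 := hs 1 {0} (by decide)
  have X1 := hs 1 {1} (by decide)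
  have X2 := hs 1 {2} (by decide)
  have X3 := hs 1 {3} (by decide)
  have Y012 := hs 0 {0, 1, 2} (by decide)
  have Y013 := hs 0 {0, 1, 3} (by decide)
  have Y023 := hs 0 {0, 2, 3} (by decide)
  have U := hs 0 {0, 1, 2, 3} (by decide)
  clear hs
  obtain ⟨s1, s2, s3, s4, s5, s6⟩ := aux_sort
  rw [aux_decomp u hdeg] at X0 X1 X2 X3 Y012 Y013 Y023 U
  simp (decide := true) [s1, s2, s3, s4, s5, s6, aux_insert D hD, aux_single D hD, aux_theta D hD,
    hD.low_eta, hD.low_one, hD.vac_pos, hD.vac_xi, hD.vac_t, Finset.erase_insert_of_ne, dsign,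
    msign, Finset.filter_insert, Finset.filter_singleton, Finset.product_singleton]
    at X0 X1 X2 X3 Y012 Y013 Y023 U
  have q10 := DFunLike.congr_fun X1 (0, {0, 1})
  have q11 := DFunLike.congr_fun Y012 (0, {1, 2})
  have q12 := DFunLike.congr_fun Y013 (0, {1, 3})
  have q13 := DFunLike.congr_fun X1 (0, {2, 3})
  have q14 := DFunLike.congr_fun X2 (0, {1, 3})
  have q15 := DFunLike.congr_fun X3 (0, {1, 2})
  have q16 := DFunLike.congr_fun Y012 (0, {0, 3})
  have q17 := DFunLike.congr_fun U (0, {0})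
  have q20 := DFunLike.congr_fun X0 (0, {0, 1})
  have q21 := DFunLike.congr_fun Y012 (0, {0, 2})
  have q22 := DFunLike.congr_fun Y013 (0, {0, 3})
  have q23 := DFunLike.congr_fun X0 (0, {2, 3})
  have q24 := DFunLike.congr_fun X2 (0, {0, 3})
  have q25 := DFunLike.congr_fun X3 (0, {0, 2})
  have q26 := DFunLike.congr_fun Y012 (0, {1, 3})
  have q27 := DFunLike.congr_fun U (0, {1})
  have q30 := DFunLike.congr_fun X0 (0, {0, 2})
  have q31 := DFunLike.congr_fun Y012 (0, {0, 1})
  have q32 := DFunLike.congr_fun Y023 (0, {0, 3})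
  have q33 := DFunLike.congr_fun X0 (0, {1, 3})
  have q34 := DFunLike.congr_fun X1 (0, {0, 3})
  have q35 := DFunLike.congr_fun X3 (0, {0, 1})
  have q36 := DFunLike.congr_fun Y012 (0, {2, 3})
  have q37 := DFunLike.congr_fun U (0, {2})
  have q40 := DFunLike.congr_fun X0 (0, {0, 3})
  have q41 := DFunLike.congr_fun Y013 (0, {0, 1})
  have q42 := DFunLike.congr_fun Y023 (0, {0, 2})
  have q43 := DFunLike.congr_fun X0 (0, {1, 2})
  have q44 := DFunLike.congr_fun X1 (0, {0, 2})
  have q45 := DFunLike.congr_fun X2 (0, {0, 1})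
  have q46 := DFunLike.congr_fun Y013 (0, {2, 3})
  have q47 := DFunLike.congr_fun U (0, {3})
  clear X0 X1 X2 X3 Y012 Y013 Y023 U
  simp (decide := true) [bv] at q10 q11 q12 q13 q14 q15 q16 q17
  simp (decide := true) [bv] at q20 q21 q22 q23 q24 q25 q26 q27
  simp (decide := true) [bv] at q30 q31 q32 q33 q34 q35 q36 q37
  simp (decide := true) [bv] at q40 q41 q42 q43 q44 q45 q46 q47
  have a1 : u (1, {0}) = (-2 : ℂ) • D.ρC (u (0, {1, 2, 3})) := by
    linear_combination (norm := module) -(q10 - q11 - q12)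
  have t1 : D.ρt (u (0, {1, 2, 3})) = (5 / 2 : ℂ) • u (0, {1, 2, 3}) := by
    linear_combination (norm := module) (-1 / 2 : ℂ) • (q13 - q14 - q16)
  have c1 : D.ρC (D.ρC (u (0, {1, 2, 3}))) = (1 / 4 : ℂ) • u (0, {1, 2, 3}) := by
    rw [a1, map_smul] at q17
    linear_combination (norm := module) (1 / 2 : ℂ) • (q17 + (q13 - q14 + q15)) + (3 / 2 : ℂ) • t1
  have a2 : u (1, {1}) = (2 : ℂ) • D.ρC (u (0, {0, 2, 3})) := by
    linear_combination (norm := module) q20 - q21 - q22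
  have t2 : D.ρt (u (0, {0, 2, 3})) = (5 / 2 : ℂ) • u (0, {0, 2, 3}) := by
    linear_combination (norm := module) (-1 / 2 : ℂ) • (q23 - q24 + q26)
  have c2 : D.ρC (D.ρC (u (0, {0, 2, 3}))) = (1 / 4 : ℂ) • u (0, {0, 2, 3}) := by
    rw [a2, map_smul] at q27
    linear_combination (norm := module) (-1 / 2 : ℂ) • (q27 - (q23 - q24 + q25)) + (3 / 2 : ℂ) • t2
  have a3 : u (1, {2}) = (-2 : ℂ) • D.ρC (u (0, {0, 1, 3})) := by
    linear_combination (norm := module) q30 + q31 - q32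
  have t3 : D.ρt (u (0, {0, 1, 3})) = (5 / 2 : ℂ) • u (0, {0, 1, 3}) := by
    linear_combination (norm := module) (-1 / 2 : ℂ) • (q33 - q34 - q36)
  have c3 : D.ρC (D.ρC (u (0, {0, 1, 3}))) = (1 / 4 : ℂ) • u (0, {0, 1, 3}) := by
    rw [a3, map_smul] at q37
    linear_combination (norm := module) (1 / 2 : ℂ) • (q37 + (q33 - q34 + q35)) + (3 / 2 : ℂ) • t3
  have a4 : u (1, {3}) = (2 : ℂ) • D.ρC (u (0, {0, 1, 2})) := by
    linear_combination (norm := module) q40 + q41 + q42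
  have t4 : D.ρt (u (0, {0, 1, 2})) = (5 / 2 : ℂ) • u (0, {0, 1, 2}) := by
    linear_combination (norm := module) (-1 / 2 : ℂ) • (q43 - q44 + q46)
  have c4 : D.ρC (D.ρC (u (0, {0, 1, 2}))) = (1 / 4 : ℂ) • u (0, {0, 1, 2}) := by
    rw [a4, map_smul] at q47
    linear_combination (norm := module) (-1 / 2 : ℂ) • (q47 - (q43 - q44 + q45)) + (3 / 2 : ℂ) • t4
  exact ⟨⟨a1, t1, c1⟩, ⟨a2, t2, c2⟩, ⟨a3, t3, c3⟩, ⟨a4, t4, c4⟩⟩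

end Aux2
section Aux3
variable {F : Type*} [AddCommGroup F] [Module ℂ F]

lemma aux_inj {k : ℕ} {L : Idx} {v w : F} (h : bv k L v = bv k L w) : v = w :=
  Finsupp.single_injective _ h

lemma aux_Cbv (f : F →ₗ[ℂ] F) (v : F) : Cop f (bv 0 ∅ v) = bv 0 ∅ (f v) := by
  simp [Cop, bv]

/-- An operator commuting with `Cop` and preserving the vacuum commutes with `ρC`. -/
lemma aux_Ccomm (D : VermaData F) (x : VInd F →ₗ[ℂ] VInd F) (f : F →ₗ[ℂ] F)
    (hx : ∀ v, x (bv 0 ∅ v) = bv 0 ∅ (f v)) (hc : x ∘ₗ Cop D.ρC = Cop D.ρC ∘ₗ x) (v : F) :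
    f (D.ρC v) = D.ρC (f v) := by
  have h := congrArg (fun g => g (bv 0 ∅ v)) hc
  simp only [LinearMap.comp_apply, aux_Cbv, hx] at h
  exact aux_inj h

lemma aux_C_eq (D : VermaData F) (hD : IsVerma D) :
    Cop D.ρC = (2 : ℂ)⁻¹ • (D.act 0 univ ∘ₗ D.act 0 ∅ - D.act 0 ∅ ∘ₗ D.act 0 univ) := by
  have h := hD.lie 0 univ 0 ∅
  have e : psi0 univ ∅ = 2 := by
    have e2 : ∀ i : Fin 4, (∅ : Idx) ≠ {i}ᶜ := by decide
    have e4 : ∀ i : Fin 4, (∅ : Idx) ≠ {i} := by decide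
    have e3 : (∅ : Idx) ≠ univ := by decide
    simp [psi0, e2, e4, e3]
  simp [brkAct, e] at h
  rw [h, smul_smul]
  norm_num

/-- If `[x, A] = c A` and `[x, E] = -c E` then `x` commutes with `C = [A, E] / 2`. -/
lemma aux_Ccomm' (D : VermaData F) (hD : IsVerma D) (x : VInd F →ₗ[ℂ] VInd F) (c : ℂ)
    (hA : x ∘ₗ D.act 0 univ - D.act 0 univ ∘ₗ x = c • D.act 0 univ)
    (hE : x ∘ₗ D.act 0 ∅ - D.act 0 ∅ ∘ₗ x = -c • D.act 0 ∅) :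
    x ∘ₗ Cop D.ρC = Cop D.ρC ∘ₗ x := by
  rw [aux_C_eq D hD]
  refine LinearMap.ext fun w => ?_
  have a1 := fun w => congrArg (fun g => g w) hA
  have e1 := fun w => congrArg (fun g => g w) hE
  simp only [LinearMap.sub_apply, LinearMap.comp_apply, LinearMap.smul_apply] at a1 e1
  have a2 := congrArg (D.act 0 ∅) (a1 w)
  have e2 := congrArg (D.act 0 univ) (e1 w)
  have a3 := a1 (D.act 0 ∅ w)
  have e3 := e1 (D.act 0 univ w)
  simp only [LinearMap.sub_apply, LinearMap.comp_apply, LinearMap.smul_apply, map_sub,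
    map_smul] at a2 e2 a3 e3 ⊢
  linear_combination (norm := module) (2⁻¹ : ℂ) • (a3 + e2 - e3 - a2)

lemma aux_xiC (D : VermaData F) (hD : IsVerma D) (i j : Fin 4) (hij : i < j) (v : F) :
    D.ρξ i j (D.ρC v) = D.ρC (D.ρξ i j v) := by
  refine aux_Ccomm D (D.act 0 {i, j}) _ (fun v => hD.vac_xi v i j hij) ?_ v
  have hc : ∀ i j : Fin 4, i < j → ({i, j} : Idx).card = 2 := by decide
  refine aux_Ccomm' D hD _ 0 ?_ ?_
  · have h := hD.lie 0 {i, j} 0 univ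
    have e1 : ∀ i j k : Fin 4, i < j →
        ¬ (k ∈ ({i, j} : Idx) ∧ k ∈ (univ : Idx) ∧
          Disjoint (({i, j} : Idx).erase k) ((univ : Idx).erase k)) := by decide
    have e2 : psi0 {i, j} univ = 0 := by
      have f1 : ∀ i j : Fin 4, ({i, j} : Idx) ≠ ∅ := by decide
      have f2 : ∀ i j : Fin 4, ({i, j} : Idx) ≠ univ := by decide
      have f3 : ∀ i j k : Fin 4, i < j → ({i, j} : Idx) ≠ {k} := by decide
      have f4 : ∀ i j k : Fin 4, i < j → ({i, j} : Idx) ≠ {k}ᶜ := by decide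
      simp [psi0, f1, f2, f3 i j _ hij, f4 i j _ hij]
    simp only [brkAct, e1 i j _ hij, e2, hc i j hij] at h
    have h8 : (-1 : ℂ) ^ 8 = 1 := by norm_num
    simpa [h8] using h
  · have h := hD.lie 0 {i, j} 0 ∅
    have e2 : psi0 {i, j} ∅ = 0 := by
      have f2 : ∀ i j : Fin 4, ({i, j} : Idx) ≠ univ := by decide
      have f3 : ∀ k : Fin 4, (∅ : Idx) ≠ {k} := by decide
      have f4 : ∀ k : Fin 4, (∅ : Idx) ≠ {k}ᶜ := by decide
      have f5 : (∅ : Idx) ≠ univ := by decide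
      simp [psi0, f2, f3, f4, f5]
    simp only [brkAct, e2, hc i j hij] at h
    simpa using h

lemma aux_tC (D : VermaData F) (hD : IsVerma D) (v : F) :
    D.ρt (D.ρC v) = D.ρC (D.ρt v) := by
  refine aux_Ccomm D (D.act 1 ∅) _ (fun v => hD.vac_t v) ?_ v
  have e : ∀ I : Idx, msign ∅ I = 1 := by decide
  refine aux_Ccomm' D hD _ 2 ?_ ?_
  · have h := hD.lie 1 ∅ 0 univ
    simp [brkAct, e] at h
    rw [h]
  · have h := hD.lie 1 ∅ 0 ∅
    simpa [brkAct, e] using h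

lemma aux_xit (D : VermaData F) (hD : IsVerma D) (i j : Fin 4) (hij : i < j) (v : F) :
    D.ρξ i j (D.ρt v) = D.ρt (D.ρξ i j v) := by
  have hc : ∀ i j : Fin 4, i < j → ({i, j} : Idx).card = 2 := by decide
  have h := congrArg (fun g => g (bv 0 ∅ v)) (hD.lie 1 ∅ 0 {i, j})
  simp [brkAct, hD.vac_t, hD.vac_xi _ i j hij, hc i j hij] at h
  exact (aux_inj (sub_eq_zero.mp h)).symm

/-- Schur's lemma, in the form used here. -/
lemma aux_schur (D : VermaData F) (hD : IsVerma D) (hirr : IsIrred D) (g : F →ₗ[ℂ] F)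
    (h1 : ∀ v, g (D.ρt v) = D.ρt (g v)) (h2 : ∀ v, g (D.ρC v) = D.ρC (g v))
    (h3 : ∀ i j, i < j → ∀ v, g (D.ρξ i j v) = D.ρξ i j (g v)) :
    (∀ v, g v = 0 → v = 0) ∨ ∀ v, g v = 0 := by
  have h3' : ∀ i j v, g (D.ρξ i j v) = D.ρξ i j (g v) := by
    intro i j v
    rcases lt_trichotomy i j with h | h | h
    · exact h3 i j h v
    · subst h
      have h0 : D.ρξ i i = 0 := by
        have h := hD.anti i i
        have h2 : (2 : ℂ) • D.ρξ i i = 0 := by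
          rw [two_smul]
          nth_rewrite 1 [h]
          simp
        simpa using h2
      simp [h0]
    · rw [hD.anti i j]
      simp [h3 j i h v]
  rcases hirr.2 (LinearMap.ker g) (by
    intro v hv
    rw [LinearMap.mem_ker] at hv
    simp [LinearMap.mem_ker, h1, h2, h3', hv]) with h | h
  · left
    intro v hv
    have : v ∈ LinearMap.ker g := hv
    rw [h] at this
    simpa using this
  · right
    intro v
    have : v ∈ LinearMap.ker g := by rw [h]; trivial
    exact this

lemma aux_scalars (D : VermaData F) (hD : IsVerma D) (hirr : IsIrred D) (b : F) (hb : b ≠ 0)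
    (ht : D.ρt b = (5 / 2 : ℂ) • b) (hC : D.ρC (D.ρC b) = (1 / 4 : ℂ) • b) :
    (D.ρC = ((1 : ℂ) / 2) • LinearMap.id ∨ D.ρC = (-(1 : ℂ) / 2) • LinearMap.id) ∧
    D.ρt = ((5 : ℂ) / 2) • LinearMap.id := by
  have tC := aux_tC D hD
  have xC := aux_xiC D hD
  have xt := aux_xit D hD
  constructor
  · have hsq : ∀ v, D.ρC (D.ρC v) = (1 / 4 : ℂ) • v := by
      rcases aux_schur D hD hirr (D.ρC ∘ₗ D.ρC - (1 / 4 : ℂ) • LinearMap.id)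
        (by intro v; simp [tC]) (by intro v; simp)
        (by intro i j h v; simp [xC i j h]) with h | h
      · exact absurd (h b (by simp [hC])) hb
      · intro v
        simpa [sub_eq_zero] using h v
    rcases aux_schur D hD hirr (D.ρC - (1 / 2 : ℂ) • LinearMap.id)
        (by intro v; simp [tC]) (by intro v; simp)
        (by intro i j h v; simp [xC i j h]) with h | h
    · right
      ext v
      have := h (D.ρC v + (1 / 2 : ℂ) • v) (by
        simp only [LinearMap.sub_apply, LinearMap.smul_apply, LinearMap.id_apply, map_add,
          map_smul, hsq]
        module)
      simp only [LinearMap.smul_apply, LinearMap.id_apply]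
      linear_combination (norm := module) this
    · left
      ext v
      simpa [sub_eq_zero] using h v
  · rcases aux_schur D hD hirr (D.ρt - (5 / 2 : ℂ) • LinearMap.id)
        (by intro v; simp) (by intro v; simp [tC])
        (by intro i j h v; simp [xt i j h]) with h | h
    · exact absurd (h b (by simp [ht])) hb
    · ext v
      simpa [sub_eq_zero] using h v

lemma aux_T (u : VInd F) (k : ℕ) (L : Idx) :
    Tmap u (k, L) = ((msign L Lᶜ : ℤ) : ℂ) • u (k, Lᶜ) := by
  induction u using Finsupp.induction_linear with
  | zero => simp
  | add f g hf hg => simp [hf, hg]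
  | single p v =>
    obtain ⟨k', L'⟩ := p
    simp only [Tmap, Finsupp.lsum_single, LinearMap.smul_apply, Finsupp.lsingle_apply,
      Finsupp.smul_apply, Finsupp.single_apply, Prod.mk.injEq]
    by_cases h : L'ᶜ = L
    · subst h
      simp
    · have h' : L' ≠ Lᶜ := fun e => h (by simp [e])
      simp [h, h']

end Aux3

/-- **Constraints on degree-3 highest weight singular vectors** (Lemma
`azioneabcdfinalgrado3finali`).
Let `u ∈ Ind F` be a highest weight singular vector of degree 3, written as
`T(u) = Θ ∑ₐ η_{(a)ᶜ} ⊗ v_{a,1} + ∑ₐ η_a ⊗ v_{a,0}`.  Then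
`v_{a,1} = (-1)^{a+1} ⋅ 2C ⋅ v_{a,0}` for every `a ∈ {1,2,3,4}` (below `a` is 0-indexed, so
the sign is `(-1)^a`), the central element `C` acts on `F` as the scalar `1/2` or `-1/2`,
and `t` acts on `F` as the scalar `5/2`. -/
theorem degree_three_singular_vector_constraints
    (F : Type*) [AddCommGroup F] [Module ℂ F] [FiniteDimensional ℂ F]
    (D : VermaData F) (hD : IsVerma D) (hirr : IsIrred D)
    (u : VInd F) (hu : IsSingular D u) (hdeg : HomogDeg u 3) (hhw : IsHW D u) :
    (∀ a : Fin 4,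
        Tmap u (1, ({a} : Idx)ᶜ)
          = ((-1 : ℂ) ^ (a : ℕ)) • ((2 : ℂ) • D.ρC (Tmap u (0, ({a} : Idx))))) ∧
    (D.ρC = ((1 : ℂ) / 2) • LinearMap.id ∨ D.ρC = (-(1 : ℂ) / 2) • LinearMap.id) ∧
    D.ρt = ((5 : ℂ) / 2) • LinearMap.id := by
  obtain ⟨r1, r2, r3, r4⟩ := aux_eqs D hD u hdeg hu.2
  refine ⟨?_, ?_⟩
  · intro a
    rw [aux_T, aux_T, compl_compl]
    have m1 : ∀ a : Fin 4, msign ({a} : Idx)ᶜ {a} = -msign {a} ({a} : Idx)ᶜ := by decide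
    have k0 : ({0} : Idx)ᶜ = {1, 2, 3} := by decide
    have k1 : ({1} : Idx)ᶜ = {0, 2, 3} := by decide
    have k2 : ({2} : Idx)ᶜ = {0, 1, 3} := by decide
    have k3 : ({3} : Idx)ᶜ = {0, 1, 2} := by decide
    rw [m1, map_smul]
    have key : u (1, {a}) = (-(-1 : ℂ) ^ (a : ℕ) * 2) • D.ρC (u (0, ({a} : Idx)ᶜ)) := by
      fin_cases a
      · simpa [k0] using r1.1
      · simpa [k1] using r2.1
      · simpa [k2] using r3.1
      · have h3 : (-(-1 : ℂ) ^ 3 * 2) = 2 := by norm_num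
        simpa [k3, h3] using r4.1
    rw [key]
    push_cast
    module
  · have hne : u (0, {1, 2, 3}) ≠ 0 ∨ u (0, {0, 2, 3}) ≠ 0 ∨ u (0, {0, 1, 3}) ≠ 0 ∨
        u (0, {0, 1, 2}) ≠ 0 := by
      by_contra! h
      obtain ⟨h1, h2, h3, h4⟩ := h
      apply hu.1
      rw [aux_decomp u hdeg, r1.1, r2.1, r3.1, r4.1, h1, h2, h3, h4]
      simp [bv]
    rcases hne with h | h | h | h
    · exact aux_scalars D hD hirr _ h r1.2.1 r1.2.2
    · exact aux_scalars D hD hirr _ h r2.2.1 r2.2.2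
    · exact aux_scalars D hD hirr _ h r3.2.1 r3.2.2
    · exact aux_scalars D hD hirr _ h r4.2.1 r4.2.2
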